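/- Let μ ∈ ℂ with μ not an integer. Over the field ℂ(x) of rational functions with its derivation D extending d/dx, let Ψ₁ and Ψ₂ be the constant 5×5 matrices of the context, let Ψ := (1/μ + 1/x)·Ψ₁ + 4μ·Ψ₂, and let b be the column vector (−32μ⁴/x, −8μ³/x, (4/3)μ²/x, 0, 0). Then the linear differential system F' = Ψ·F + b has no solution F with all five components in ℂ(x) (where F' denotes componentwise application of D). (This non-existence is the computational core of the proof that the Painlevé III equation with parameters (2μ−1, −2μ+1, 1, −1), μ ∉ ℤ, is irreducible.) -/

import Mathlib

set_option synthInstance.maxHeartbeats 1000000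
set_option maxHeartbeats 1000000

noncomputable def Ψ₁ : Matrix (Fin 5) (Fin 5) (RatFunc ℂ) :=
  !![0, 0, 0, 0, 0;
     1, 0, 0, 0, 0;
     0, -2, 0, 0, 0;
     0, 0, -3, 0, 0;
     0, 0, 0, -4, 0]

noncomputable def Ψ₂ : Matrix (Fin 5) (Fin 5) (RatFunc ℂ) :=
  !![0, 4, 0, 0, 0;
     0, 0, -3, 0, 0;
     0, 0, 0, -2, 0;
     0, 0, 0, 0, -1;
     0, 0, 0, 0, 0]

/-- The local ring at the origin inside `ℂ(x)`: rational functions with no pole at `0`. -/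
def regularAtZero : Subalgebra ℂ (RatFunc ℂ) where
  carrier := {f | ∃ p q : Polynomial ℂ, q.eval 0 ≠ 0 ∧
    f * algebraMap (Polynomial ℂ) (RatFunc ℂ) q = algebraMap (Polynomial ℂ) (RatFunc ℂ) p}
  mul_mem' := by
    rintro f g ⟨p, q, hq, hf⟩ ⟨r, s, hs, hg⟩
    refine ⟨p * r, q * s, by simp [hq, hs], ?_⟩
    rw [map_mul, map_mul, ← hf, ← hg]
    ring
  add_mem' := by
    rintro f g ⟨p, q, hq, hf⟩ ⟨r, s, hs, hg⟩
    refine ⟨p * s + r * q, q * s, by simp [hq, hs], ?_⟩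
    rw [map_add, map_mul, map_mul, map_mul, ← hf, ← hg]
    ring
  algebraMap_mem' c := ⟨Polynomial.C c, 1, by simp, by simp [RatFunc.algebraMap_eq_C]⟩

theorem C_mem_regularAtZero (c : ℂ) : RatFunc.C c ∈ regularAtZero := by
  rw [← RatFunc.algebraMap_eq_C]
  exact regularAtZero.algebraMap_mem c

theorem X_mem_regularAtZero : (RatFunc.X : RatFunc ℂ) ∈ regularAtZero :=
  ⟨Polynomial.X, 1, by simp, by simp⟩

theorem inv_X_notMem_regularAtZero : (RatFunc.X : RatFunc ℂ)⁻¹ ∉ regularAtZero := by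
  rintro ⟨p, q, hq, h⟩
  rw [inv_mul_eq_iff_eq_mul₀ RatFunc.X_ne_zero, ← RatFunc.algebraMap_X, ← map_mul] at h
  rw [RatFunc.algebraMap_injective ℂ h] at hq
  simp at hq

theorem derivation_mem_regularAtZero (D : Derivation ℂ (RatFunc ℂ) (RatFunc ℂ))
    (hD : ∀ p : Polynomial ℂ,
      D (algebraMap (Polynomial ℂ) (RatFunc ℂ) p) =
        algebraMap (Polynomial ℂ) (RatFunc ℂ) (Polynomial.derivative p))
    {f : RatFunc ℂ} (hf : f ∈ regularAtZero) : D f ∈ regularAtZero := by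
  obtain ⟨p, q, hq, h⟩ := hf
  refine ⟨Polynomial.derivative p * q - p * Polynomial.derivative q, q * q, by simp [hq], ?_⟩
  have h' := congrArg D h
  rw [D.leibniz, hD, hD, smul_eq_mul, smul_eq_mul] at h'
  rw [map_sub, map_mul, map_mul, map_mul, ← h, ← h']
  ring

theorem exists_X_pow_mul_mem_regularAtZero (f : RatFunc ℂ) :
    ∃ n : ℕ, RatFunc.X ^ n * f ∈ regularAtZero := by
  obtain ⟨q, hq, hdvd⟩ := Polynomial.exists_eq_pow_rootMultiplicity_mul_and_not_dvd f.denom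
    f.denom_ne_zero 0
  set n := f.denom.rootMultiplicity 0
  refine ⟨n, f.num, q, by rwa [Polynomial.dvd_iff_isRoot] at hdvd, ?_⟩
  have hden : algebraMap (Polynomial ℂ) (RatFunc ℂ) f.denom ≠ 0 :=
    RatFunc.algebraMap_ne_zero f.denom_ne_zero
  have hf : f * algebraMap (Polynomial ℂ) (RatFunc ℂ) f.denom = algebraMap _ _ f.num := by
    nth_rewrite 1 [← RatFunc.num_div_denom f]
    exact div_mul_cancel₀ _ hden
  rw [← hf, hq]
  simp only [map_mul, map_pow, Polynomial.C_0, sub_zero, RatFunc.algebraMap_X]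
  ring

/-- If `D f = g + h / x` with `x ^ m * h` and `x ^ (m + 1) * g` regular at `0`, then the pole order
of `f` at `0` is not exactly `m + 1`. -/
theorem X_pow_mul_mem_regularAtZero_of_succ (D : Derivation ℂ (RatFunc ℂ) (RatFunc ℂ))
    (hD : ∀ p : Polynomial ℂ,
      D (algebraMap (Polynomial ℂ) (RatFunc ℂ) p) =
        algebraMap (Polynomial ℂ) (RatFunc ℂ) (Polynomial.derivative p))
    {f g h : RatFunc ℂ} {m : ℕ} (hf : D f = g + h / RatFunc.X)
    (hfm : RatFunc.X ^ (m + 1) * f ∈ regularAtZero)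
    (hg : RatFunc.X ^ (m + 1) * g ∈ regularAtZero) (hh : RatFunc.X ^ m * h ∈ regularAtZero) :
    RatFunc.X ^ m * f ∈ regularAtZero := by
  have hX : D RatFunc.X = 1 := by simpa using hD Polynomial.X
  have hm : ((m : RatFunc ℂ) + 1) ≠ 0 := by exact_mod_cast m.succ_ne_zero
  have hx : (RatFunc.X : RatFunc ℂ) ≠ 0 := RatFunc.X_ne_zero
  have hinv : ((m : RatFunc ℂ) + 1)⁻¹ ∈ regularAtZero := by
    simpa using C_mem_regularAtZero ((m : ℂ) + 1)⁻¹
  have key : RatFunc.X ^ m * f = ((m : RatFunc ℂ) + 1)⁻¹ *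
      (D (RatFunc.X ^ (m + 1) * f) - RatFunc.X ^ (m + 1) * g - RatFunc.X ^ m * h) := by
    rw [D.leibniz, D.leibniz_pow, hf, hX]
    simp only [smul_eq_mul, nsmul_eq_mul, Nat.add_sub_cancel]
    push_cast
    field_simp
    ring
  rw [key]
  exact mul_mem hinv (sub_mem (sub_mem (derivation_mem_regularAtZero D hD hfm) hg) hh)

/-- For `μ ∈ ℂ` not an integer, the system `F' = Ψ F + b`, with
`Ψ = (1/μ + 1/x)Ψ₁ + 4μΨ₂` and `b = (−32μ⁴/x, −8μ³/x, (4/3)μ²/x, 0, 0)ᵀ`, has no solution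
with all components in `ℂ(x)` (where `D` is the unique derivation of `ℂ(x)` extending the
formal derivative of polynomials). This is the computational core of the irreducibility of
the Painlevé III equation with parameters `(2μ−1, −2μ+1, 1, −1)`, `μ ∉ ℤ`. -/
theorem stmt_15 (μ : ℂ) (hμ : ∀ k : ℤ, μ ≠ (k : ℂ))
    (D : Derivation ℂ (RatFunc ℂ) (RatFunc ℂ))
    (hD : ∀ p : Polynomial ℂ,
      D (algebraMap (Polynomial ℂ) (RatFunc ℂ) p) =
        algebraMap (Polynomial ℂ) (RatFunc ℂ) (Polynomial.derivative p)) :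
    ¬ ∃ F : Fin 5 → RatFunc ℂ,
      (fun i => D (F i)) =
        (((RatFunc.C μ)⁻¹ + (RatFunc.X : RatFunc ℂ)⁻¹) • Ψ₁
            + (4 * RatFunc.C μ) • Ψ₂).mulVec F
          + ![-32 * RatFunc.C μ ^ 4 / RatFunc.X,
              -8 * RatFunc.C μ ^ 3 / RatFunc.X,
              (4 / 3) * RatFunc.C μ ^ 2 / RatFunc.X, 0, 0] := by
  rintro ⟨F, hF⟩
  have hμ0 : μ ≠ 0 := by simpa using hμ 0
  have hnat (n : ℕ) [n.AtLeastTwo] : RatFunc.C (OfNat.ofNat n : ℂ) = OfNat.ofNat n :=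
    map_ofNat RatFunc.C n
  have hC : ∀ (c : ℂ) {f : RatFunc ℂ}, f ∈ regularAtZero → RatFunc.C c * f ∈ regularAtZero :=
    fun c _ hf => mul_mem (C_mem_regularAtZero c) hf
  have e0 : D (F 0) = RatFunc.C (16 * μ) * F 1 + RatFunc.C (-32 * μ ^ 4) / RatFunc.X := by
    have h := congrFun hF 0
    simp [Ψ₁, Ψ₂, dotProduct, Fin.sum_univ_five] at h
    rw [h]
    simp only [map_mul, map_neg, map_pow, hnat]
    ring
  have e1 : D (F 1) = (RatFunc.C μ⁻¹ * F 0 + RatFunc.C (-12 * μ) * F 2) +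
      (F 0 + RatFunc.C (-8 * μ ^ 3)) / RatFunc.X := by
    have h := congrFun hF 1
    simp [Ψ₁, Ψ₂, dotProduct, Fin.sum_univ_five] at h
    rw [h]
    simp [hnat]
    ring
  have e2 : D (F 2) = (RatFunc.C (-2 * μ⁻¹) * F 1 + RatFunc.C (-8 * μ) * F 3) +
      (RatFunc.C (-2) * F 1 + RatFunc.C (4 / 3 * μ ^ 2)) / RatFunc.X := by
    have h := congrFun hF 2
    simp [Ψ₁, Ψ₂, dotProduct, Fin.sum_univ_five] at h
    rw [h]
    simp [hnat]
    ring
  have e3 : D (F 3) = (RatFunc.C (-3 * μ⁻¹) * F 2 + RatFunc.C (-4 * μ) * F 4) +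
      (RatFunc.C (-3) * F 2) / RatFunc.X := by
    have h := congrFun hF 3
    simp [Ψ₁, Ψ₂, dotProduct, Fin.sum_univ_five] at h
    rw [h]
    simp [hnat]
    ring
  have e4 : D (F 4) = RatFunc.C (-4 * μ⁻¹) * F 3 + (RatFunc.C (-4) * F 3) / RatFunc.X := by
    have h := congrFun hF 4
    simp [Ψ₁, Ψ₂, dotProduct, Fin.sum_univ_five] at h
    rw [h]
    simp [hnat]
    ring
  have hlin : ∀ (n : ℕ) (c : ℂ) {f : RatFunc ℂ}, RatFunc.X ^ n * f ∈ regularAtZero →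
      RatFunc.X ^ n * (RatFunc.C c * f) ∈ regularAtZero := fun n c f hf => by
    rw [mul_left_comm]
    exact hC c hf
  have hadd : ∀ (n : ℕ) {f g : RatFunc ℂ}, RatFunc.X ^ n * f ∈ regularAtZero →
      RatFunc.X ^ n * g ∈ regularAtZero → RatFunc.X ^ n * (f + g) ∈ regularAtZero :=
    fun n f g hf hg => by
      rw [mul_add]
      exact add_mem hf hg
  have hconst : ∀ (n : ℕ) (c : ℂ), RatFunc.X ^ n * RatFunc.C c ∈ regularAtZero := fun n c =>
    mul_mem (pow_mem X_mem_regularAtZero n) (C_mem_regularAtZero c)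
  have descend : ∀ m : ℕ, (∀ i, RatFunc.X ^ (m + 1) * F i ∈ regularAtZero) →
      ∀ i, RatFunc.X ^ m * F i ∈ regularAtZero := by
    intro m h
    have h0 := X_pow_mul_mem_regularAtZero_of_succ D hD e0 (h 0) (hlin _ _ (h 1)) (hconst _ _)
    have h1 := X_pow_mul_mem_regularAtZero_of_succ D hD e1 (h 1)
      (hadd _ (hlin _ _ (h 0)) (hlin _ _ (h 2))) (hadd _ h0 (hconst _ _))
    have h2 := X_pow_mul_mem_regularAtZero_of_succ D hD e2 (h 2)
      (hadd _ (hlin _ _ (h 1)) (hlin _ _ (h 3))) (hadd _ (hlin _ _ h1) (hconst _ _))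
    have h3 := X_pow_mul_mem_regularAtZero_of_succ D hD e3 (h 3)
      (hadd _ (hlin _ _ (h 2)) (hlin _ _ (h 4))) (hlin _ _ h2)
    have h4 := X_pow_mul_mem_regularAtZero_of_succ D hD e4 (h 4) (hlin _ _ (h 3)) (hlin _ _ h3)
    intro i
    fin_cases i
    exacts [h0, h1, h2, h3, h4]
  choose n hn using fun i => exists_X_pow_mul_mem_regularAtZero (F i)
  have hN : ∀ i, RatFunc.X ^ (∑ j, n j) * F i ∈ regularAtZero := fun i => by
    rw [← Finset.sum_erase_add _ _ (Finset.mem_univ i), pow_add, mul_assoc]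
    exact mul_mem (pow_mem X_mem_regularAtZero _) (hn i)
  have hreg : ∀ N : ℕ, (∀ i, RatFunc.X ^ N * F i ∈ regularAtZero) → ∀ i, F i ∈ regularAtZero := by
    intro N
    induction N with
    | zero => simp
    | succ m ih => exact fun h => ih (descend m h)
  have hF' := hreg _ hN
  apply inv_X_notMem_regularAtZero
  have hinv : (RatFunc.X : RatFunc ℂ)⁻¹ =
      RatFunc.C (-32 * μ ^ 4)⁻¹ * (D (F 0) - RatFunc.C (16 * μ) * F 1) := by
    have hne : RatFunc.C (-32 * μ ^ 4) ≠ 0 := by simp [hμ0]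
    rw [e0, map_inv₀, add_sub_cancel_left, div_eq_mul_inv, inv_mul_cancel_left₀ hne]
  rw [hinv]
  exact hC _ (sub_mem (derivation_mem_regularAtZero D hD (hF' 0)) (hC _ (hF' 1)))
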